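/- Fix T > 0, r ∈ ℝ, and let f : ℝ → ℝ be Borel measurable with linear growth: |f(z)| ≤ C(1 + |z|). Define, for σ > 0, F(t,x,σ) = e^{−r(T−t)} ∫ f(x · exp((r − σ²/2)(T−t) + σ√(T−t) · y)) dφ(y), with φ = gaussianReal 0 1. Then for all t ∈ [0,T), x > 0 and σ > 0, ∂F/∂σ (t,x,σ) = (T−t) · σ · x² · ∂²F/∂x² (t,x,σ). (The vega of a European option equals (T−t)σx² times its gamma.) -/

import Mathlib

open MeasureTheory ProbabilityTheory Filter Set Topology Real

/-- The Black–Scholes value `F(t,x,σ)` at time `t` of the European option with payoff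
`f(S_T)` when the stock price at time `t` is `x` and the volatility parameter is `σ`:
`F(t,x,σ) = e^{−r(T−t)} ∫ f(x e^{(r−σ²/2)(T−t) + σ√(T−t) y}) dφ(y)`, `φ = N(0,1)`. -/
noncomputable def bsF (T σ r : ℝ) (f : ℝ → ℝ) (t x : ℝ) : ℝ :=
  Real.exp (-r * (T - t)) *
    ∫ y, f (x * Real.exp ((r - σ ^ 2 / 2) * (T - t) + σ * Real.sqrt (T - t) * y))
      ∂(gaussianReal 0 1)

/-- At most exponential growth of a function on the real line. -/
def ExpGrowth (h : ℝ → ℝ) : Prop :=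
  ∃ M B : ℝ, ∀ w, |h w| ≤ M * Real.exp (B * |w|)

lemma ExpGrowth.id_mul {h : ℝ → ℝ} (hh : ExpGrowth h) : ExpGrowth (fun w => w * h w) := by
  obtain ⟨M, B, hM⟩ := hh
  refine ⟨M, B + 1, fun w => ?_⟩
  have h1 : |w| ≤ Real.exp |w| := by linarith [Real.add_one_le_exp |w|]
  calc |w * h w| = |w| * |h w| := abs_mul _ _
    _ ≤ Real.exp |w| * (M * Real.exp (B * |w|)) :=
        mul_le_mul h1 (hM w) (abs_nonneg _) (Real.exp_pos _).le
    _ = M * Real.exp ((B + 1) * |w|) := by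
        rw [add_mul, one_mul, Real.exp_add]; ring

lemma integrable_exp_mul_abs_sub_mul_sq (B : ℝ) {d : ℝ} (hd : 0 < d) :
    Integrable (fun w : ℝ => Real.exp (B * |w| - d * w ^ 2)) := by
  refine ((integrable_exp_neg_mul_sq (half_pos hd)).const_mul
    (Real.exp (B ^ 2 / (2 * d)))).mono' (by fun_prop) (ae_of_all _ fun w => ?_)
  rw [Real.norm_eq_abs, Real.abs_exp, ← Real.exp_add, Real.exp_le_exp]
  have h1 : B ^ 2 / (2 * d) + -(d / 2) * w ^ 2 - (B * |w| - d * w ^ 2)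
      = (d * |w| - B) ^ 2 / (2 * d) := by
    rw [← sq_abs w]; field_simp; ring
  have h2 : 0 ≤ (d * |w| - B) ^ 2 / (2 * d) := by positivity
  linarith

lemma ExpGrowth.integrable_mul_exp {h : ℝ → ℝ} (hh : ExpGrowth h) (hm : Measurable h)
    (b : ℝ) {c : ℝ} (hc : 0 < c) :
    Integrable (fun w : ℝ => h w * Real.exp (b * w - c * w ^ 2)) := by
  obtain ⟨M, B, hM⟩ := hh
  refine ((integrable_exp_mul_abs_sub_mul_sq (B + |b|) hc).const_mul M).mono'
    (by fun_prop) (ae_of_all _ fun w => ?_)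
  have h1 : b * w ≤ |b| * |w| := (le_abs_self _).trans (abs_mul _ _).le
  rw [Real.norm_eq_abs, abs_mul, Real.abs_exp]
  have hM0 : 0 ≤ M := by
    have := (abs_nonneg _).trans (hM 0)
    simpa using this
  calc |h w| * Real.exp (b * w - c * w ^ 2)
      ≤ (M * Real.exp (B * |w|)) * Real.exp (|b| * |w| - c * w ^ 2) := by
        gcongr; exact hM w
    _ = M * Real.exp ((B + |b|) * |w| - c * w ^ 2) := by
        rw [mul_assoc, ← Real.exp_add]; ring_nf

/-- The unnormalised Gaussian integral of `h` with natural parameters `b` and `c`. -/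
noncomputable def quadExpIntegral (h : ℝ → ℝ) (b c : ℝ) : ℝ :=
  ∫ w, h w * Real.exp (b * w - c * w ^ 2)

lemma hasFDerivAt_quadExpIntegral {h : ℝ → ℝ} (hh : ExpGrowth h) (hm : Measurable h)
    (b : ℝ) {c : ℝ} (hc : 0 < c) :
    HasFDerivAt (fun p : ℝ × ℝ => quadExpIntegral h p.1 p.2)
      (quadExpIntegral (fun w => w * h w) b c • ContinuousLinearMap.fst ℝ ℝ ℝ
        - quadExpIntegral (fun w => w * (w * h w)) b c • ContinuousLinearMap.snd ℝ ℝ ℝ)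
      (b, c) := by
  have hm1 : Measurable fun w => w * h w := by fun_prop
  have hm2 : Measurable fun w => w * (w * h w) := by fun_prop
  have i1 := hh.id_mul.integrable_mul_exp hm1 b hc
  have i2 := hh.id_mul.id_mul.integrable_mul_exp hm2 b hc
  have habs : ∀ k : ℝ → ℝ, ExpGrowth k → Measurable k →
      Integrable (fun w : ℝ => |k w| * Real.exp ((|b| + c) * |w| - c / 2 * w ^ 2)) := by
    rintro k ⟨M, B, hM⟩ hk
    refine ((integrable_exp_mul_abs_sub_mul_sq (B + (|b| + c)) (half_pos hc)).const_mul M).mono'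
      (by fun_prop) (ae_of_all _ fun w => ?_)
    rw [Real.norm_eq_abs, abs_mul, Real.abs_exp, abs_abs, add_mul B, add_sub_assoc, Real.exp_add,
      ← mul_assoc]
    gcongr
    exact hM w
  have key := hasFDerivAt_integral_of_dominated_of_fderiv_le (𝕜 := ℝ) (μ := volume)
    (F := fun (p : ℝ × ℝ) w => h w * Real.exp (p.1 * w - p.2 * w ^ 2))
    (F' := fun (p : ℝ × ℝ) w =>
      (w * h w * Real.exp (p.1 * w - p.2 * w ^ 2)) • ContinuousLinearMap.fst ℝ ℝ ℝ
        - (w * (w * h w) * Real.exp (p.1 * w - p.2 * w ^ 2)) • ContinuousLinearMap.snd ℝ ℝ ℝ)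
    (x₀ := (b, c)) (s := Metric.ball (b, c) (c / 2))
    (bound := fun w => |w * h w| * Real.exp ((|b| + c) * |w| - c / 2 * w ^ 2)
      + |w * (w * h w)| * Real.exp ((|b| + c) * |w| - c / 2 * w ^ 2))
    (Metric.ball_mem_nhds _ (half_pos hc))
    (Eventually.of_forall fun p => by fun_prop)
    (hh.integrable_mul_exp hm b hc)
    ((i1.smul_const _).sub (i2.smul_const _)).aestronglyMeasurable
    (ae_of_all _ fun w p hp => ?_)
    ((habs _ hh.id_mul hm1).add (habs _ hh.id_mul.id_mul hm2))
    (ae_of_all _ fun w p hp => ?_)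
  · rw [integral_sub (i1.smul_const _) (i2.smul_const _), integral_smul_const,
      integral_smul_const] at key
    exact key
  · obtain ⟨p1, p2⟩ := p
    rw [Metric.mem_ball, Prod.dist_eq, max_lt_iff, Real.dist_eq, Real.dist_eq] at hp
    obtain ⟨hp1, hp2⟩ := hp
    have hexp : Real.exp (p1 * w - p2 * w ^ 2)
        ≤ Real.exp ((|b| + c) * |w| - c / 2 * w ^ 2) := by
      rw [Real.exp_le_exp]
      have hb : |p1| ≤ |b| + c := by
        have := abs_sub_abs_le_abs_sub p1 b
        dsimp only at hp1
        linarith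
      have hc2 : c / 2 ≤ p2 := by
        have := (abs_lt.1 hp2).1
        dsimp only at this
        linarith
      have h1 : p1 * w ≤ (|b| + c) * |w| :=
        ((le_abs_self _).trans (abs_mul _ _).le).trans (by gcongr)
      have h2 : c / 2 * w ^ 2 ≤ p2 * w ^ 2 := by gcongr
      linarith
    refine (norm_sub_le _ _).trans ?_
    rw [norm_smul, norm_smul, Real.norm_eq_abs, Real.norm_eq_abs, abs_mul, abs_mul (w * (w * h w)),
      Real.abs_exp]
    refine add_le_add ?_ ?_
    · refine (mul_le_of_le_one_right (by positivity)
        (ContinuousLinearMap.norm_fst_le ℝ ℝ ℝ)).trans (by gcongr)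
    · refine (mul_le_of_le_one_right (by positivity)
        (ContinuousLinearMap.norm_snd_le ℝ ℝ ℝ)).trans (by gcongr)
  · have h1 : HasFDerivAt (fun p : ℝ × ℝ => p.1 * w - p.2 * w ^ 2)
        (w • ContinuousLinearMap.fst ℝ ℝ ℝ - w ^ 2 • ContinuousLinearMap.snd ℝ ℝ ℝ) p :=
      (hasFDerivAt_fst.mul_const w).sub (hasFDerivAt_snd.mul_const (w ^ 2))
    refine (h1.exp.const_mul (h w)).congr_fderiv ?_
    simp only [smul_sub, smul_smul]
    congr 2 <;> ring

/-- The mean of `h` under the normal law with mean `m` and standard deviation `s`. -/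
noncomputable def normalMean (h : ℝ → ℝ) (m s : ℝ) : ℝ :=
  ∫ y, h (m + s * y) ∂(gaussianReal 0 1)

lemma normalMean_eq (h : ℝ → ℝ) (m : ℝ) {s : ℝ} (hs : 0 < s) :
    normalMean h m s = (Real.sqrt (2 * π))⁻¹ * (s⁻¹ * Real.exp (-m ^ 2 / (2 * s ^ 2)))
      * quadExpIntegral h (m / s ^ 2) (1 / (2 * s ^ 2)) := by
  let k : ℝ → ℝ := fun w => (Real.sqrt (2 * π))⁻¹ * Real.exp (-m ^ 2 / (2 * s ^ 2)) *
    (h w * Real.exp (m / s ^ 2 * w - 1 / (2 * s ^ 2) * w ^ 2))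
  have hk : normalMean h m s = ∫ y, k (m + s * y) := by
    rw [normalMean, integral_gaussianReal_eq_integral_smul one_ne_zero]
    refine integral_congr_ae (ae_of_all _ fun y => ?_)
    have : Real.exp (-y ^ 2 / 2) = Real.exp (-m ^ 2 / (2 * s ^ 2)) *
        Real.exp (m / s ^ 2 * (m + s * y) - 1 / (2 * s ^ 2) * (m + s * y) ^ 2) := by
      rw [← Real.exp_add]; congr 1; field_simp; ring
    simp only [k, gaussianPDFReal, smul_eq_mul, sub_zero, NNReal.coe_one, mul_one]
    rw [this]; ring
  rw [hk, Measure.integral_comp_mul_left (fun w => k (m + w)) s,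
    integral_add_left_eq_self (μ := volume) k m, integral_const_mul, abs_of_pos (inv_pos.2 hs), smul_eq_mul,
    quadExpIntegral]
  ring

/-- Derivative of the normal mean along a curve of means and standard deviations. -/
lemma hasDerivAt_normalMean {h : ℝ → ℝ} (hh : ExpGrowth h) (hmeas : Measurable h)
    {m s : ℝ → ℝ} {m' s' θ : ℝ} (hm : HasDerivAt m m' θ) (hs : HasDerivAt s s' θ)
    (hpos : 0 < s θ) :
    HasDerivAt (fun θ => normalMean h (m θ) (s θ))
      (m' * ((normalMean (fun w => w * h w) (m θ) (s θ)
          - m θ * normalMean h (m θ) (s θ)) / s θ ^ 2)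
        + s' * ((normalMean (fun w => w * (w * h w)) (m θ) (s θ)
          - 2 * m θ * normalMean (fun w => w * h w) (m θ) (s θ)
          + (m θ ^ 2 - s θ ^ 2) * normalMean h (m θ) (s θ)) / s θ ^ 3)) θ := by
  have hne : s θ ≠ 0 := hpos.ne'
  have hb := hm.fun_div (hs.fun_pow 2) (pow_ne_zero 2 hne)
  have hc := (hasDerivAt_const θ (1 : ℝ)).fun_div ((hs.fun_pow 2).const_mul 2)
    (mul_ne_zero two_ne_zero (pow_ne_zero 2 hne))
  have hE := (hasFDerivAt_quadExpIntegral hh hmeas (m θ / s θ ^ 2)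
    (c := 1 / (2 * s θ ^ 2)) (by positivity)).comp_hasDerivAt θ (hb.prodMk hc)
  have hA := ((hs.fun_inv hne).fun_mul ((hm.fun_pow 2).fun_neg.fun_div ((hs.fun_pow 2).const_mul 2)
    (mul_ne_zero two_ne_zero (pow_ne_zero 2 hne))).exp).const_mul (Real.sqrt (2 * π))⁻¹
  have hev : (fun θ => normalMean h (m θ) (s θ)) =ᶠ[𝓝 θ] _ :=
    (hs.continuousAt.eventually (lt_mem_nhds hpos)).mono fun θ hθ => normalMean_eq h (m θ) hθ
  refine ((hA.fun_mul hE).congr_of_eventuallyEq hev).congr_deriv ?_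
  rw [normalMean_eq _ _ hpos, normalMean_eq _ _ hpos, normalMean_eq _ _ hpos]
  simp only [_root_.sub_apply, _root_.smul_apply,
    ContinuousLinearMap.coe_fst', ContinuousLinearMap.coe_snd', smul_eq_mul, Function.comp]
  field_simp
  ring

lemma ExpGrowth.comp_exp {f : ℝ → ℝ} {C : ℝ} (hgrowth : ∀ z, |f z| ≤ C * (1 + |z|)) :
    ExpGrowth (fun w => f (Real.exp w)) := by
  have hC : 0 ≤ C := by simpa using (abs_nonneg _).trans (hgrowth 0)
  refine ⟨2 * C, 1, fun w => (hgrowth _).trans ?_⟩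
  have h1 : Real.exp w ≤ Real.exp |w| := Real.exp_le_exp.2 (le_abs_self w)
  have h2 : 1 ≤ Real.exp |w| := Real.one_le_exp (abs_nonneg w)
  rw [Real.abs_exp, one_mul]
  nlinarith

lemma bsF_eq_normalMean (T σ r : ℝ) (f : ℝ → ℝ) (t : ℝ) {x : ℝ} (hx : 0 < x) :
    bsF T σ r f t x = Real.exp (-r * (T - t)) * normalMean (fun w => f (Real.exp w))
      (Real.log x + (r - σ ^ 2 / 2) * (T - t)) (σ * Real.sqrt (T - t)) := by
  simp only [bsF, normalMean, add_assoc, Real.exp_add (Real.log x), Real.exp_log hx]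

/-- The vega of a European option equals `(T−t) σ x²` times its gamma: for `f` Borel
measurable with linear growth, `∂F/∂σ (t,x,σ) = (T−t) σ x² ∂²F/∂x² (t,x,σ)` for all
`t ∈ [0,T)`, `x > 0`, `σ > 0`. -/
theorem stmt13 (T r : ℝ) (hT : 0 < T)
    (f : ℝ → ℝ) (hfmeas : Measurable f)
    (C : ℝ) (hgrowth : ∀ z, |f z| ≤ C * (1 + |z|)) :
    ∀ t ∈ Set.Ico (0 : ℝ) T, ∀ x : ℝ, 0 < x → ∀ σ : ℝ, 0 < σ →
      deriv (fun σ' => bsF T σ' r f t x) σ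
        = (T - t) * σ * x ^ 2 * deriv (deriv (fun x' => bsF T σ r f t x')) x := by
  rintro t ⟨-, ht⟩ x hx σ hσ
  have hτ : 0 < T - t := sub_pos.2 ht
  have hq : 0 < Real.sqrt (T - t) := Real.sqrt_pos.2 hτ
  have hq2 : Real.sqrt (T - t) ^ 2 = T - t := Real.sq_sqrt hτ.le
  have hs : 0 < σ * Real.sqrt (T - t) := by positivity
  have hgr := ExpGrowth.comp_exp hgrowth
  have hgm : Measurable fun w => f (Real.exp w) := hfmeas.comp Real.measurable_exp
  have hgm1 : Measurable fun w => w * f (Real.exp w) := measurable_id.mul hgm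
  have hvega := ((hasDerivAt_normalMean hgr hgm
    (((((hasDerivAt_id σ).fun_pow 2).div_const 2).const_sub r).mul_const (T - t)
      |>.const_add (Real.log x))
    ((hasDerivAt_id σ).mul_const (Real.sqrt (T - t))) hs).const_mul
      (Real.exp (-r * (T - t)))).deriv
  have hmean : ∀ z : ℝ, 0 < z →
      HasDerivAt (fun z => Real.log z + (r - σ ^ 2 / 2) * (T - t)) z⁻¹ z :=
    fun z hz => (Real.hasDerivAt_log hz.ne').add_const _
  have hdelta : deriv (fun x' => bsF T σ r f t x') =ᶠ[𝓝 x] _ :=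
    (lt_mem_nhds hx).mono fun z hz =>
      (((hasDerivAt_normalMean hgr hgm (hmean z hz) (hasDerivAt_const z _) hs).const_mul
        (Real.exp (-r * (T - t)))).congr_of_eventuallyEq
          ((lt_mem_nhds hz).mono fun _ hy => bsF_eq_normalMean T σ r f t hy)).deriv
  have hU0 := hasDerivAt_normalMean hgr hgm (hmean x hx) (hasDerivAt_const x _) hs
  have hU1 := hasDerivAt_normalMean hgr.id_mul hgm1 (hmean x hx) (hasDerivAt_const x _) hs
  simp only [zero_mul, add_zero] at hdelta hU0 hU1
  have hgamma := (((hasDerivAt_inv hx.ne').fun_mul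
    ((hU1.fun_sub ((hmean x hx).fun_mul hU0)).div_const
      ((σ * Real.sqrt (T - t)) ^ 2))).const_mul (Real.exp (-r * (T - t)))).deriv
  rw [hdelta.deriv_eq, hgamma]
  simp only [bsF_eq_normalMean T _ r f t hx]
  simp only [id] at hvega
  rw [hvega]
  generalize normalMean (fun w => w * (w * f (Real.exp w))) _ _ = u2
  generalize normalMean (fun w => w * f (Real.exp w)) _ _ = u1
  generalize normalMean (fun w => f (Real.exp w)) _ _ = u0
  generalize Real.log x + (r - σ ^ 2 / 2) * (T - t) = m
  generalize Real.exp (-r * (T - t)) = d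
  generalize Real.sqrt (T - t) = q at hq hq2
  rw [← hq2]
  field_simp
  ring
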